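/- Let g be a finite-dimensional real semisimple Lie algebra with negative-definite Killing form, and let m ⊆ g be a linear subspace. Let u ∈ m be an element at which the dimension of the center of the centralizer is maximal, i.e., dim z(c_g(u)) ≥ dim z(c_g(v)) for all v ∈ m. Then (dim g − dim c_g(u)) + dim z(c_g(u)) ≥ dim m, where c_g(u) = {x ∈ g : [x,u] = 0} and z(k) denotes the center of a Lie algebra k. -/

import Mathlib

open NormedSpace Filter Topology

/-- `exp D` and `exp (-D)` are inverse to each other. -/
lemma aux_exp_mul_neg {E : Type*} [NormedAddCommGroup E] [NormedSpace ℝ E] [CompleteSpace E]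
    (D : E →L[ℝ] E) : exp D * exp (-D) = 1 := by
  let _ : NormedAlgebra ℚ (E →L[ℝ] E) := NormedAlgebra.restrictScalars ℚ ℝ _
  rw [← exp_add_of_commute (by simp)]; simp

/-- The exponential of a derivation is an automorphism. -/
lemma aux_exp_deriv {E : Type*} [NormedAddCommGroup E] [NormedSpace ℝ E] [CompleteSpace E]
    (β : E →L[ℝ] E →L[ℝ] E) (D : E →L[ℝ] E)
    (hD : ∀ x y, D (β x y) = β (D x) y + β x (D y)) (a b : E) :
    exp D (β a b) = β (exp D a) (exp D b) := by
  have key : ∀ t : ℝ, HasDerivAt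
      (fun t : ℝ => exp (t • (-D)) (β (exp (t • D) a) (exp (t • D) b))) 0 t := by
    intro t
    have h1 := hasDerivAt_exp_smul_const (𝕂 := ℝ) (-D) t
    have h2 := hasDerivAt_exp_smul_const' (𝕂 := ℝ) D t
    have ha := h2.clm_apply (hasDerivAt_const t a)
    have hb := h2.clm_apply (hasDerivAt_const t b)
    have hβ := (β.hasFDerivAt.comp_hasDerivAt t ha).clm_apply hb
    refine (h1.clm_apply hβ).congr_deriv ?_
    simp [hD]
  have hc := is_const_of_deriv_eq_zero (fun t => (key t).differentiableAt)
    (fun t => (key t).deriv) 0 1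
  simp only [zero_smul, exp_zero, one_smul, one_apply_eq_self] at hc
  rw [hc, ← mul_apply_eq_comp, aux_exp_mul_neg]
  simp

set_option maxHeartbeats 1000000 in
lemma aux_core {E : Type*} [NormedAddCommGroup E] [NormedSpace ℝ E] [FiniteDimensional ℝ E]
    (β : E →L[ℝ] E →L[ℝ] E) (hskew : ∀ x y, β x y = - β y x)
    (hjac : ∀ x y z, β x (β y z) = β (β x y) z + β y (β x z))
    (zc : E → Submodule ℝ E)
    (hzc : ∀ v x, x ∈ zc v ↔ (β x v = 0 ∧ ∀ y, β y v = 0 → β x y = 0))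
    (u : E) (hu : ∀ y, β u (β u y) = 0 → β u y = 0)
    (w : E) (hmax : ∀ t : ℝ, Module.finrank ℝ (zc (u + t • w)) ≤ Module.finrank ℝ (zc u)) :
    w ∈ (β u : E →ₗ[ℝ] E).range ⊔ zc u := by
  have : CompleteSpace E := FiniteDimensional.complete ℝ E
  set R : Submodule ℝ E := (β u : E →ₗ[ℝ] E).range with hR
  set C : Submodule ℝ E := (β u : E →ₗ[ℝ] E).ker with hC
  have memC : ∀ x, x ∈ C ↔ β u x = 0 := fun x => by simp [hC]
  have memR : ∀ x, β u x ∈ R := fun x => ⟨x, rfl⟩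
  have hRC : ∀ x ∈ R, β u x = 0 → x = 0 := by
    rintro _ ⟨y, rfl⟩ h; exact hu y h
  -- the centralizer does not grow
  have hself : ∀ x, β x x = 0 := fun x => by
    have h2 : (2 : ℝ) • β x x = 0 := by
      rw [two_smul]; exact eq_neg_iff_add_eq_zero.1 (hskew x x)
    exact (smul_eq_zero.1 h2).resolve_left two_ne_zero
  have hsmall : ∀ᶠ s : C in 𝓝 (0 : C), ∀ y, β y (u + (s : E)) = 0 → β y u = 0 := by
    obtain ⟨K, hK, hanti⟩ := LinearMap.exists_antilipschitzWith
      ((β u : E →ₗ[ℝ] E) ∘ₗ R.subtype) (by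
        rw [LinearMap.ker_eq_bot']
        rintro ⟨x, hx⟩ h
        exact Subtype.ext (hRC x hx h))
    have hcont : Continuous (fun s : C => (K : ℝ) * ‖β (s : E)‖) := by fun_prop
    have hlt : ∀ᶠ s : C in 𝓝 (0 : C), (K : ℝ) * ‖β (s : E)‖ < 1 := by
      apply hcont.continuousAt.eventually_lt_const
      simp
    filter_upwards [hlt] with s hs y hy
    have hsC : β u (s : E) = 0 := (memC _).1 s.2
    have hy' : β u y + β s y = 0 := by
      have := hskew (u + s) y
      rw [hy] at this
      simpa using this
    have h1 : β u (β u y) = - β s (β u y) := by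
      have := congrArg (β u) hy'
      rw [map_add, hjac u s y, hsC] at this
      simp only [map_zero, zero_apply, zero_add] at this
      exact eq_neg_of_add_eq_zero_left this
    have h2 : ‖β u y‖ ≤ K * ‖β u (β u y)‖ := by
      have := hanti.le_mul_dist (⟨β u y, memR y⟩ : R) 0
      simpa [dist_eq_norm] using this
    have h3 : ‖β u y‖ = 0 := by
      have h4 : ‖β u (β u y)‖ ≤ ‖β (s : E)‖ * ‖β u y‖ := by
        rw [h1, norm_neg]; exact (β (s : E)).le_opNorm _
      have h5 : ‖β u y‖ ≤ (K * ‖β (s : E)‖) * ‖β u y‖ := by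
        rw [mul_assoc]
        exact h2.trans (mul_le_mul_of_nonneg_left h4 K.2)
      nlinarith [norm_nonneg (β u y)]
    rw [hskew, norm_eq_zero.1 h3, neg_zero]
  -- automorphism
  have haut : ∀ x v, Module.finrank ℝ (zc v) ≤ Module.finrank ℝ (zc (exp (β x) v)) := by
    intro x v
    have hexp := aux_exp_deriv β (β x) (hjac x)
    have hi1 : ∀ y, exp (β x) (exp (-β x) y) = y := fun y => by
      rw [← mul_apply_eq_comp, aux_exp_mul_neg]; rfl
    have hi2 : ∀ y, exp (-β x) (exp (β x) y) = y := fun y => by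
      have := aux_exp_mul_neg (-β x)
      rw [neg_neg] at this
      rw [← mul_apply_eq_comp, this]; rfl
    let φ : E ≃ₗ[ℝ] E := LinearEquiv.ofLinearMap (exp (β x) : E →L[ℝ] E).toLinearMap
      (exp (-β x) : E →L[ℝ] E).toLinearMap
      (LinearMap.ext hi1) (LinearMap.ext hi2)
    rw [← LinearEquiv.finrank_map_eq φ (zc v)]
    apply Submodule.finrank_mono
    rintro _ ⟨y, hy, rfl⟩
    have hy := (hzc _ _).1 hy
    change exp (β x) y ∈ _
    rw [hzc]
    refine ⟨by rw [← hexp, hy.1, map_zero], fun q hq => ?_⟩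
    rw [← hi1 q, ← hexp] at hq ⊢
    have hq' := congrArg (fun z => (exp (-β x) : E →L[ℝ] E) z) hq
    simp only [hi2, map_zero] at hq'
    rw [hy.2 _ hq', map_zero]
  -- the slice map
  let Φ : R × C → E := fun p => exp (β (p.1 : E)) (u + (p.2 : E))
  let L : (R × C) →L[ℝ] E :=
    (β.flip u) ∘L R.subtypeL ∘L ContinuousLinearMap.fst ℝ R C
      + C.subtypeL ∘L ContinuousLinearMap.snd ℝ R C
  have hLapp : ∀ p : R × C, L p = β (p.1 : E) u + (p.2 : E) := fun p => rfl
  have hLinj : Function.Injective (L : (R × C) →ₗ[ℝ] E) := by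
    rw [← LinearMap.ker_eq_bot, LinearMap.ker_eq_bot']
    rintro ⟨⟨x, hx⟩, ⟨s, hs⟩⟩ h
    replace h : β x u + s = 0 := h
    rw [hskew x u] at h
    have hs' : s = β u x := by
      rw [neg_add_eq_zero] at h; exact h.symm
    have : s = 0 := hRC s (hs' ▸ memR x) ((memC s).1 hs)
    have hx0 : x = 0 := hRC x hx (by rw [← hs', this])
    subst this hx0
    rfl
  have hdim : Module.finrank ℝ (R × C) = Module.finrank ℝ E := by
    rw [Module.finrank_prod]
    exact LinearMap.finrank_range_add_finrank_ker (β u : E →ₗ[ℝ] E)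
  let A : (R × C) ≃L[ℝ] E :=
    (LinearEquiv.ofInjectiveOfFinrankEq (L : (R × C) →ₗ[ℝ] E) hLinj hdim).toContinuousLinearEquiv
  have hA : (A : (R × C) →L[ℝ] E) = L := by
    ext p <;> rfl
  have hΦ : HasStrictFDerivAt Φ (A : (R × C) →L[ℝ] E) (0 : R × C) := by
    rw [hA]
    let M : (R × C) →L[ℝ] (E →L[ℝ] E) := β ∘L R.subtypeL ∘L ContinuousLinearMap.fst ℝ R C
    have e1 : HasStrictFDerivAt (fun p : R × C => exp (M p)) 
        ((1 : (E →L[ℝ] E) →L[ℝ] (E →L[ℝ] E)) ∘L M) (0 : R × C) := by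
      have h0 : HasStrictFDerivAt (exp : (E →L[ℝ] E) → (E →L[ℝ] E))
          (1 : (E →L[ℝ] E) →L[ℝ] (E →L[ℝ] E)) (M 0) := by
        rw [map_zero]; exact hasStrictFDerivAt_exp_zero (𝕂 := ℝ)
      exact h0.comp (0 : R × C) M.hasStrictFDerivAt
    have e2 : HasStrictFDerivAt (fun p : R × C => u + (p.2 : E))
        (C.subtypeL ∘L ContinuousLinearMap.snd ℝ R C) (0 : R × C) :=
      (C.subtypeL ∘L ContinuousLinearMap.snd ℝ R C).hasStrictFDerivAt.const_add u
    refine (e1.clm_apply e2).congr_fderiv ?_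
    apply ContinuousLinearMap.ext
    intro p
    rw [hLapp]
    change exp (M 0) (p.2 : E) + β (p.1 : E) (u + ((0 : C) : E)) = _
    rw [map_zero, exp_zero, Submodule.coe_zero, add_zero, add_comm]
    rfl
  have hΦ0 : Φ 0 = u := by simp [Φ]
  let ψ := hΦ.localInverse Φ A 0
  have hψ : HasStrictFDerivAt ψ (A.symm : E →L[ℝ] R × C) u := by
    have := hΦ.to_localInverse
    rwa [hΦ0] at this
  have hψ0 : ψ u = 0 := by
    have := hΦ.localInverse_apply_image
    rwa [hΦ0] at this
  have hinv : ∀ᶠ y in 𝓝 u, Φ (ψ y) = y := by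
    have := hΦ.eventually_right_inverse
    rwa [hΦ0] at this
  have hline : HasDerivAt (fun t : ℝ => u + t • w) w 0 := by
    simpa using ((hasDerivAt_id (0 : ℝ)).smul_const w).const_add u
  have htend : Tendsto (fun t : ℝ => u + t • w) (𝓝 0) (𝓝 u) := by
    simpa using hline.continuousAt.tendsto
  have hs0 : Tendsto (fun t : ℝ => (ψ (u + t • w)).2) (𝓝 0) (𝓝 0) := by
    have h := (hψ.continuousAt.tendsto.comp htend)
    rw [hψ0] at h
    exact (continuous_snd.tendsto (0 : R × C)).comp h
  have hmem : ∀ᶠ t in 𝓝 (0 : ℝ), ((ψ (u + t • w)).2 : E) ∈ zc u := by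
    filter_upwards [htend.eventually hinv, hs0.eventually hsmall] with t ht hst
    set s := (ψ (u + t • w)).2 with hs
    have hle : Module.finrank ℝ (zc (u + (s : E))) ≤ Module.finrank ℝ (zc u) := by
      refine (haut ((ψ (u + t • w)).1 : E) _).trans ?_
      have : exp (β ((ψ (u + t • w)).1 : E)) (u + (s : E)) = u + t • w := ht
      rw [this]
      exact hmax t
    have hsC : β u (s : E) = 0 := (memC _).1 s.2
    have hsub : zc u ≤ zc (u + (s : E)) := by
      intro x hx
      rw [hzc] at hx ⊢
      refine ⟨?_, fun y hy => hx.2 y (hst y hy)⟩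
      rw [map_add, hx.1, hx.2 s (by rw [hskew, hsC, neg_zero]), add_zero]
    have heq := Submodule.eq_of_le_of_finrank_le hsub hle
    rw [heq, hzc]
    have hsu : β (s : E) u = 0 := by rw [hskew, hsC, neg_zero]
    refine ⟨by rw [map_add, hsu, hself, add_zero], fun y hy => ?_⟩
    have h1 := hst y hy
    rw [map_add, h1, zero_add] at hy
    rw [hskew, hy, neg_zero]
  -- differentiate
  have hder : HasDerivAt (fun t : ℝ => ((ψ (u + t • w)).2 : E)) ((A.symm w).2 : E) 0 := by
    have h1 : HasFDerivAt ψ (A.symm : E →L[ℝ] R × C) (u + (0 : ℝ) • w) := by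
      simpa using hψ.hasFDerivAt
    have h2 := h1.comp_hasDerivAt (0 : ℝ) hline
    exact (C.subtypeL ∘L ContinuousLinearMap.snd ℝ R C).hasFDerivAt.comp_hasDerivAt (0 : ℝ) h2
  have hfin : ((A.symm w).2 : E) ∈ zc u := by
    have hcl : IsClosed (zc u : Set E) := (zc u).closed_of_finiteDimensional
    have htd := hder.tendsto_slope
    refine hcl.mem_of_tendsto htd ?_
    filter_upwards [hmem.filter_mono nhdsWithin_le_nhds] with t ht
    rw [slope_def_module]
    refine (zc u).smul_mem _ ((zc u).sub_mem ht ?_)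
    exact hmem.self_of_nhds
  have hw : w = β ((A.symm w).1 : E) u + ((A.symm w).2 : E) := by
    rw [← hLapp, ← hA]; simp
  rw [hw]
  refine Submodule.add_mem_sup ?_ hfin
  rw [hskew]
  exact R.neg_mem (memR _)


/- Part (2) of Lemma 5.2: `g` is a finite-dimensional real semisimple Lie algebra
with negative-definite Killing form and `m ⊆ g` a linear subspace.  If `u ∈ m`
maximizes `dim z(c_g(v))` over `v ∈ m`, then
`dim Ad(G)u + dim z(c_g(u)) = (dim g − dim c_g(u)) + dim z(c_g(u)) ≥ dim m`.
Here `c_g(v)` is the centralizer of `v` and `z(c_g(v))` its center. -/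
theorem statement_12
    {g : Type*} [LieRing g] [LieAlgebra ℝ g] [FiniteDimensional ℝ g]
    [LieAlgebra.IsSemisimple ℝ g]
    (hkilling : ∀ x : g, x ≠ 0 → killingForm ℝ g x x < 0)
    (m : Submodule ℝ g)
    (cg : g → Submodule ℝ g)
    (hcg : ∀ (v x : g), x ∈ cg v ↔ ⁅x, v⁆ = 0)
    (zc : g → Submodule ℝ g)
    (hzc : ∀ (v x : g), x ∈ zc v ↔
      (⁅x, v⁆ = 0 ∧ ∀ y : g, ⁅y, v⁆ = 0 → ⁅x, y⁆ = 0))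
    (u : g) (hu : u ∈ m)
    (hmax : ∀ v ∈ m, Module.finrank ℝ (zc v) ≤ Module.finrank ℝ (zc u)) :
    (Module.finrank ℝ m : ℤ) ≤
      ((Module.finrank ℝ g : ℤ) - (Module.finrank ℝ (cg u) : ℤ)) +
        (Module.finrank ℝ (zc u) : ℤ) := by
  classical
  let n := Module.finrank ℝ g
  let e : g ≃ₗ[ℝ] (Fin n → ℝ) := (Module.finBasis ℝ g).equivFun
  let E := Fin n → ℝ
  let β₀ : E →ₗ[ℝ] E →ₗ[ℝ] E := LinearMap.mk₂ ℝ (fun x y => e ⁅e.symm x, e.symm y⁆)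
    (by intros; simp) (by intros; simp) (by intros; simp) (by intros; simp)
  let β : E →L[ℝ] E →L[ℝ] E := LinearMap.toContinuousBilinearMap β₀
  have hβ : ∀ x y, β x y = e ⁅e.symm x, e.symm y⁆ := fun x y => rfl
  have hβ0 : ∀ x y, β x y = 0 ↔ ⁅e.symm x, e.symm y⁆ = 0 := fun x y => by
    rw [hβ]; simp
  have hcore : m ≤ (LieAlgebra.ad ℝ g u).range ⊔ zc u := by
    intro w hw
    have := aux_core β
      (fun x y => by rw [hβ, hβ, ← map_neg, lie_skew])
      (fun x y z => by simp only [hβ, ← map_add, LinearEquiv.symm_apply_apply]; rw [leibniz_lie])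
      (fun v => (zc (e.symm v)).map (e : g →ₗ[ℝ] E))
      (fun v x => by
        rw [Submodule.mem_map_equiv, hzc, hβ0]
        refine and_congr_right fun _ => ⟨fun h y hy => ?_, fun h y hy => ?_⟩
        · rw [hβ0] at hy ⊢; exact h _ hy
        · have := h (e y) (by rw [hβ0]; simpa using hy)
          rw [hβ0] at this; simpa using this)
      (e u)
      (fun y hy => by
        rw [hβ0] at hy ⊢
        rw [hβ] at hy
        simp only [LinearEquiv.symm_apply_apply] at hy ⊢
        by_contra hne
        have h1 := hkilling _ hne
        have h2 : killingForm ℝ g ⁅e.symm y, u⁆ ⁅u, e.symm y⁆ = 0 := by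
          rw [killingForm, LieModule.traceForm_apply_lie_apply, hy, map_zero]
        have h3 : killingForm ℝ g ⁅u, e.symm y⁆ ⁅u, e.symm y⁆
            = - killingForm ℝ g ⁅e.symm y, u⁆ ⁅u, e.symm y⁆ := by
          rw [← LinearMap.neg_apply, ← map_neg, lie_skew]
        rw [h3, h2] at h1
        simp at h1)
      (e w)
      (fun t => by
        rw [LinearEquiv.finrank_map_eq, LinearEquiv.finrank_map_eq]
        rw [map_add, map_smul, LinearEquiv.symm_apply_apply, LinearEquiv.symm_apply_apply]
        exact hmax _ (m.add_mem hu (m.smul_mem t hw)))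
    obtain ⟨_, ⟨y, rfl⟩, _, ⟨z, hz, rfl⟩, hyz⟩ := Submodule.mem_sup.1 this
    refine Submodule.mem_sup.2 ⟨⁅u, e.symm y⁆, ⟨e.symm y, rfl⟩, z, by simpa using hz, ?_⟩
    apply e.injective
    rw [map_add, ← hyz]
    simp [hβ]
  have hker : (LieAlgebra.ad ℝ g u).ker = cg u := by
    ext x
    rw [hcg, LinearMap.mem_ker, LieAlgebra.ad_apply, ← lie_skew, neg_eq_zero]
  have h1 := LinearMap.finrank_range_add_finrank_ker (LieAlgebra.ad ℝ g u : g →ₗ[ℝ] g)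
  rw [hker] at h1
  have h2 := Submodule.finrank_mono hcore
  have h3 := Submodule.finrank_add_le_finrank_add_finrank (LieAlgebra.ad ℝ g u).range (zc u)
  omega
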